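/- (Proposition 2, bar supergradient.) Let F : 2^[N] → ℝ be a normalized submodular set function and let X ⊆ [N]. Define the modular function s̄_X by the weights s̄_X({j}) = F([N]) − F([N] \ {j}) for j ∈ X, and s̄_X({j}) = F({j}) for j ∉ X. Then s̄_X is a supergradient of F at X; that is, F(Y) ≤ F(X) + s̄_X(Y) − s̄_X(X) for every Y ⊆ [N]. -/

import Mathlib

/-- A normalized submodular function grows by at most the sum of the singleton values. -/
theorem submodular_union_le_add_sum_singleton {α : Type*} [DecidableEq α] {F : Finset α → ℝ}
    (hnorm : F ∅ = 0) (hsub : ∀ X Y : Finset α, F (X ∩ Y) + F (X ∪ Y) ≤ F X + F Y)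
    {A B : Finset α} (h : Disjoint A B) :
    F (A ∪ B) ≤ F A + ∑ i ∈ B, F {i} := by
  induction B using Finset.induction_on with
  | empty => simp
  | insert j B hj ih =>
    obtain ⟨hjA, hAB⟩ := Finset.disjoint_insert_right.mp h
    have hinter : (A ∪ B) ∩ {j} = ∅ := by
      simp [hjA, hj]
    have hunion : (A ∪ B) ∪ {j} = A ∪ insert j B := by
      ext
      simp
    have key := hsub (A ∪ B) {j}
    rw [hinter, hunion, hnorm] at key
    rw [Finset.sum_insert hj]
    linarith [ih hAB]

/-- A submodular function grows by at least the sum of the marginal gains at the top. -/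
theorem submodular_add_sum_top_gain_le_union {α : Type*} [Fintype α] [DecidableEq α]
    {F : Finset α → ℝ} (hsub : ∀ X Y : Finset α, F (X ∩ Y) + F (X ∪ Y) ≤ F X + F Y)
    {A B : Finset α} (h : Disjoint A B) :
    F A + ∑ i ∈ B, (F Finset.univ - F (Finset.univ.erase i)) ≤ F (A ∪ B) := by
  induction B using Finset.induction_on with
  | empty => simp
  | insert j B hj ih =>
    obtain ⟨hjA, hAB⟩ := Finset.disjoint_insert_right.mp h
    have hinter : (A ∪ insert j B) ∩ Finset.univ.erase j = A ∪ B := by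
      ext x
      by_cases hx : x = j <;> simp [hx, hjA, hj]
    have hunion : (A ∪ insert j B) ∪ Finset.univ.erase j = Finset.univ := by
      ext x
      by_cases hx : x = j <;> simp [hx]
    have key := hsub (A ∪ insert j B) (Finset.univ.erase j)
    rw [hinter, hunion] at key
    rw [Finset.sum_insert hj]
    linarith [ih hAB]

/-- Proposition 2, bar supergradient. -/
theorem bar_supergradient
    (N : ℕ)
    (F : Finset (Fin N) → ℝ)
    (hnorm : F ∅ = 0)
    (hsub : ∀ X Y : Finset (Fin N), F (X ∩ Y) + F (X ∪ Y) ≤ F X + F Y)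
    (X : Finset (Fin N))
    (s : Fin N → ℝ)
    (hs : ∀ j : Fin N,
      s j = if j ∈ X then F Finset.univ - F (Finset.univ.erase j) else F {j}) :
    ∀ Y : Finset (Fin N),
      F Y ≤ F X + (∑ i ∈ Y, s i) - (∑ i ∈ X, s i) := by
  intro Y
  have upper := submodular_union_le_add_sum_singleton hnorm hsub
    (Finset.disjoint_sdiff_inter Y X).symm
  have lower := submodular_add_sum_top_gain_le_union hsub
    (Finset.disjoint_sdiff_inter X Y).symm
  rw [Finset.union_comm, Finset.sdiff_union_inter] at upper lower
  have hYX : ∑ i ∈ Y \ X, s i = ∑ i ∈ Y \ X, F {i} :=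
    Finset.sum_congr rfl fun i hi => by rw [hs, if_neg (Finset.mem_sdiff.mp hi).2]
  have hXY : ∑ i ∈ X \ Y, s i =
      ∑ i ∈ X \ Y, (F Finset.univ - F (Finset.univ.erase i)) :=
    Finset.sum_congr rfl fun i hi => by rw [hs, if_pos (Finset.mem_sdiff.mp hi).1]
  have sumY := Finset.sum_inter_add_sum_sdiff Y X s
  have sumX := Finset.sum_inter_add_sum_sdiff X Y s
  rw [Finset.inter_comm] at upper sumY
  linarith
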